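/- Let (X,f) be a dynamical system and let 𝓕 be a Furstenberg family that is a filter. Then the following are equivalent: (1) (X,f) is 𝓕-sensitive; (2) (K(X), f̄) is 𝓕-sensitive; (3) (F^1(X), f̃_g) is 𝓕-sensitive for some g ∈ D_m(I) with g⁻¹(1) = {1}; (4) (F^1(X), f̃_g) is 𝓕-sensitive for every g ∈ D_m(I) with g⁻¹(1) = {1}. -/

import Mathlib

noncomputable section

open Set Metric

/-- The unit interval `I = [0,1]` as a subset of `ℝ`. -/
def I01 : Set ℝ := Set.Icc 0 1

/-- `g ∈ D_m(I)`: `g : I → I` is nondecreasing, right-continuous, `g 0 = 0`, `g 1 = 1`. -/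
def Dm (g : ℝ → ℝ) : Prop :=
  MonotoneOn g I01 ∧
  (∀ x ∈ I01, ContinuousWithinAt g (I01 ∩ Set.Ici x) x) ∧
  Set.MapsTo g I01 I01 ∧ g 0 = 0 ∧ g 1 = 1

/-- `ξ_g x = min g⁻¹([x,1])` (the min exists by right-continuity; `sInf` here). -/
def xiG (g : ℝ → ℝ) (x : ℝ) : ℝ := sInf {t | t ∈ I01 ∧ x ≤ g t}

/-- The `α`-cut `[A]_α` of a fuzzy set `A`. -/
def cut {X : Type*} (A : X → ℝ) (α : ℝ) : Set X := {x | α ≤ A x}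

/-- The support of a fuzzy set. -/
def supp {X : Type*} [TopologicalSpace X] (A : X → ℝ) : Set X := closure {x | 0 < A x}

/-- The `g`-cut `[A]_α^g = {x ∈ supp A : g (A x) ≥ α}`. -/
def gcut {X : Type*} [TopologicalSpace X] (g : ℝ → ℝ) (A : X → ℝ) (α : ℝ) : Set X :=
  {x | x ∈ supp A ∧ α ≤ g (A x)}

/-- `A ∈ F(X)`: an upper semicontinuous fuzzy set on `X`. -/
def IsFuzzy {X : Type*} [TopologicalSpace X] (A : X → ℝ) : Prop :=
  UpperSemicontinuous A ∧ ∀ x, A x ∈ I01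

/-- `A ∈ F_0(X)`: a nonempty (not identically 0) upper semicontinuous fuzzy set. -/
def InF0 {X : Type*} [TopologicalSpace X] (A : X → ℝ) : Prop := IsFuzzy A ∧ ∃ x, A x ≠ 0

/-- `A ∈ F^1(X)`: an upper semicontinuous fuzzy set attaining the value 1. -/
def InF1 {X : Type*} [TopologicalSpace X] (A : X → ℝ) : Prop := IsFuzzy A ∧ ∃ x, 1 ≤ A x

/-- The `g`-fuzzification `f̃_g(A)(x) = sup {g (A y) : y ∈ f⁻¹(x)}` (with `sup ∅ = 0`). -/
def fuzz {X : Type*} (f : X → X) (g : ℝ → ℝ) (A : X → ℝ) : X → ℝ :=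
  fun x => sSup ((fun y => g (A y)) '' (f ⁻¹' {x}))

open Classical in
/-- Hausdorff metric, extended by `d_H(∅,∅) = 0` and `d_H(∅,A) = diam X`. -/
def dH {X : Type*} [MetricSpace X] (A B : Set X) : ℝ :=
  if A = ∅ ∧ B = ∅ then 0
  else if A = ∅ ∨ B = ∅ then Metric.diam (Set.univ : Set X)
  else Metric.hausdorffDist A B

/-- The levelwise metric `d_∞(A,B) = sup {d_H([A]_α, [B]_α) : α ∈ (0,1]}`. -/
def dInfty {X : Type*} [MetricSpace X] (A B : X → ℝ) : ℝ :=
  sSup ((fun α => dH (cut A α) (cut B α)) '' Set.Ioc (0:ℝ) 1)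

/-- `K(X)`: the hyperspace of nonempty compact subsets of `X`. -/
def Kc (X : Type*) [MetricSpace X] : Set (Set X) := {A | IsCompact A ∧ A.Nonempty}

section Dyn

variable {Y : Type*}

/-- `U` is a (relatively) open subset of the space `(S, ρ)`. -/
def IsOpenIn (S : Set Y) (ρ : Y → Y → ℝ) (U : Set Y) : Prop :=
  U ⊆ S ∧ ∀ x ∈ U, ∃ ε > 0, ∀ y ∈ S, ρ x y < ε → y ∈ U

/-- Diameter of a set with respect to the distance function `ρ`. -/
def diamIn (ρ : Y → Y → ℝ) (U : Set Y) : ℝ := sSup (Set.image2 ρ U U)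

/-- Sensitive dependence on initial conditions of `T` on the space `(S, ρ)`. -/
def SensitiveOn (S : Set Y) (ρ : Y → Y → ℝ) (T : Y → Y) : Prop :=
  ∃ δ > 0, ∀ x ∈ S, ∀ ε > 0, ∃ y ∈ S, ρ x y < ε ∧ ∃ n : ℕ, δ < ρ (T^[n] x) (T^[n] y)

/-- `𝓕`-sensitivity of `T` on the space `(S, ρ)`. -/
def FSensitiveOn (S : Set Y) (ρ : Y → Y → ℝ) (T : Y → Y) (F : Set (Set ℕ)) : Prop :=
  ∃ ε > 0, ∀ U : Set Y, IsOpenIn S ρ U → U.Nonempty →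
    {n : ℕ | ε < diamIn ρ (T^[n] '' U)} ∈ F

/-- Multi-sensitivity of `T` on the space `(S, ρ)`. -/
def MultiSensitiveOn (S : Set Y) (ρ : Y → Y → ℝ) (T : Y → Y) : Prop :=
  ∃ ε > 0, ∀ (k : ℕ) (U : Fin k → Set Y),
    (∀ i, IsOpenIn S ρ (U i) ∧ (U i).Nonempty) →
    ∃ n : ℕ, ∀ i, ε < diamIn ρ (T^[n] '' U i)

/-- Topological transitivity of `T` on the space `(S, ρ)`. -/
def TransitiveOn (S : Set Y) (ρ : Y → Y → ℝ) (T : Y → Y) : Prop :=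
  ∀ U V : Set Y, IsOpenIn S ρ U → U.Nonempty → IsOpenIn S ρ V → V.Nonempty →
    ∃ n : ℕ, ((T^[n] '' U) ∩ V).Nonempty

/-- Weak mixing: `T × T` is transitive on `(S × S, max-metric)`. -/
def WeaklyMixingOn (S : Set Y) (ρ : Y → Y → ℝ) (T : Y → Y) : Prop :=
  TransitiveOn (S ×ˢ S) (fun p q => max (ρ p.1 q.1) (ρ p.2 q.2)) (Prod.map T T)

end Dyn

/-- A (proper) Furstenberg family on `ℤ⁺ = ℕ`. -/
def FurstenbergFamily (F : Set (Set ℕ)) : Prop :=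
  (∀ F1 F2 : Set ℕ, F1 ∈ F → F1 ⊆ F2 → F2 ∈ F) ∧ Set.univ ∈ F ∧ ∅ ∉ F

lemma dH_of_nonempty {X : Type*} [MetricSpace X] {A B : Set X} (hA : A.Nonempty)
    (hB : B.Nonempty) : dH A B = hausdorffDist A B := by
  simp [dH, hA.ne_empty, hB.ne_empty]

section CompactSpace

variable {X : Type*} [MetricSpace X]

lemma exists_lt_dist_of_lt_dH {A B : Set X} {r : ℝ} (hr : 0 ≤ r) (hA : A.Nonempty)
    (hB : B.Nonempty) (h : r < dH A B) : ∃ a ∈ A, ∃ b ∈ B, r < dist a b := by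
  rw [dH_of_nonempty hA hB] at h
  by_contra! H
  obtain ⟨a, ha⟩ := hA
  obtain ⟨b, hb⟩ := hB
  exact h.not_ge (hausdorffDist_le_of_mem_dist hr (fun x hx => ⟨b, hb, H x hx b hb⟩)
    (fun x hx => ⟨a, ha, by rw [dist_comm]; exact H a ha x hx⟩))

lemma dInfty_le {A B : X → ℝ} {r : ℝ}
    (h : ∀ α ∈ Ioc (0 : ℝ) 1, dH (cut A α) (cut B α) ≤ r) : dInfty A B ≤ r := by
  refine csSup_le ⟨_, mem_image_of_mem _ (right_mem_Ioc.2 one_pos)⟩ ?_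
  rintro _ ⟨β, hβ, rfl⟩
  exact h β hβ

lemma exists_lt_dH_of_lt_dInfty {A B : X → ℝ} {r : ℝ} (h : r < dInfty A B) :
    ∃ α ∈ Ioc (0 : ℝ) 1, r < dH (cut A α) (cut B α) := by
  by_contra! H
  exact h.not_ge (dInfty_le H)

variable [CompactSpace X]

lemma hausdorffEDist_ne_top_of_nonempty {A B : Set X} (hA : A.Nonempty) (hB : B.Nonempty) :
    hausdorffEDist A B ≠ ⊤ :=
  hausdorffEDist_ne_top_of_nonempty_of_bounded hA hB
    (isCompact_univ.isBounded.subset (subset_univ A))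
    (isCompact_univ.isBounded.subset (subset_univ B))

lemma dist_le_diam_univ (x y : X) : dist x y ≤ diam (univ : Set X) :=
  dist_le_diam_of_mem isCompact_univ.isBounded (mem_univ x) (mem_univ y)

lemma dH_le_diam_univ (A B : Set X) : dH A B ≤ diam (univ : Set X) := by
  rcases A.eq_empty_or_nonempty with rfl | hA
  · rcases B.eq_empty_or_nonempty with rfl | hB
    · simp [dH, diam_nonneg]
    · simp [dH, hB.ne_empty]
  rcases B.eq_empty_or_nonempty with rfl | hB
  · simp [dH, hA.ne_empty]
  rw [dH_of_nonempty hA hB]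
  obtain ⟨a, ha⟩ := hA
  obtain ⟨b, hb⟩ := hB
  exact hausdorffDist_le_of_mem_dist diam_nonneg
    (fun x _ => ⟨b, hb, dist_le_diam_univ x b⟩) (fun x _ => ⟨a, ha, dist_le_diam_univ x a⟩)

lemma exists_dist_lt_of_dH_lt {A B : Set X} {r : ℝ} (hA : A.Nonempty) (hB : B.Nonempty)
    (h : dH A B < r) {b : X} (hb : b ∈ B) : ∃ a ∈ A, dist a b < r := by
  rw [dH_of_nonempty hA hB] at h
  exact exists_dist_lt_of_hausdorffDist_lt' hb h (hausdorffEDist_ne_top_of_nonempty hA hB)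

lemma dH_cut_le_dInfty (A B : X → ℝ) {α : ℝ} (hα : α ∈ Ioc (0 : ℝ) 1) :
    dH (cut A α) (cut B α) ≤ dInfty A B := by
  refine le_csSup ⟨diam (univ : Set X), ?_⟩ (mem_image_of_mem _ hα)
  rintro _ ⟨β, _, rfl⟩
  exact dH_le_diam_univ _ _

lemma dInfty_le_diam_univ (A B : X → ℝ) : dInfty A B ≤ diam (univ : Set X) :=
  dInfty_le fun _ _ => dH_le_diam_univ _ _

end CompactSpace

lemma lt_diamIn {Y : Type*} {ρ : Y → Y → ℝ} {U : Set Y} {C δ : ℝ} (hC : ∀ x y, ρ x y ≤ C)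
    {x y : Y} (hx : x ∈ U) (hy : y ∈ U) (h : δ < ρ x y) : δ < diamIn ρ U := by
  refine h.trans_le (le_csSup ⟨C, ?_⟩ (mem_image2_of_mem hx hy))
  rintro _ ⟨a, _, b, _, rfl⟩
  exact hC a b

lemma exists_lt_of_lt_diamIn {Y : Type*} {ρ : Y → Y → ℝ} {T : Y → Y} {U : Set Y} {δ : ℝ}
    (hU : U.Nonempty) (h : δ < diamIn ρ (T '' U)) :
    ∃ x ∈ U, ∃ y ∈ U, δ < ρ (T x) (T y) := by
  obtain ⟨_, ⟨_, ⟨x, hx, rfl⟩, _, ⟨y, hy, rfl⟩, rfl⟩, h⟩ :=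
    exists_lt_of_lt_csSup ((hU.image T).image2 (hU.image T)) h
  exact ⟨x, hx, y, hy, h⟩

lemma isOpenIn_univ_ball {X : Type*} [MetricSpace X] (x : X) (r : ℝ) :
    IsOpenIn univ dist (ball x r) :=
  ⟨subset_univ _, fun y hy => by
    obtain ⟨ε, hε, h⟩ := isOpen_iff.1 isOpen_ball y hy
    exact ⟨ε, hε, fun z _ hz => h (by rwa [mem_ball, dist_comm])⟩⟩

lemma FurstenbergFamily.biInter_mem {F : Set (Set ℕ)} (hF : FurstenbergFamily F)
    (hfil : ∀ F1 ∈ F, ∀ F2 ∈ F, F1 ∩ F2 ∈ F) {ι : Type*} {t : Set ι} (ht : t.Finite)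
    {N : ι → Set ℕ} (hN : ∀ i ∈ t, N i ∈ F) : ⋂ i ∈ t, N i ∈ F := by
  induction t, ht using Set.Finite.induction_on with
  | empty => simpa using hF.2.1
  | insert _ _ ih =>
    rw [biInter_insert]
    exact hfil _ (hN _ (mem_insert _ _)) _ (ih fun i hi => hN i (mem_insert_of_mem _ hi))

/-- Under `𝓕`-sensitivity, every compact set `A` is approximated by pairs of finite sets whose
iterates are far apart, for `𝓕`-many times. -/
lemma exists_finite_approx {X : Type*} [MetricSpace X] [CompactSpace X] {f : X → X}
    {F : Set (Set ℕ)} (hF : FurstenbergFamily F) (hfil : ∀ F1 ∈ F, ∀ F2 ∈ F, F1 ∩ F2 ∈ F)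
    {ε : ℝ} (hε : 0 < ε) (h : ∀ U : Set X, IsOpenIn univ dist U → U.Nonempty →
      {n : ℕ | ε < diamIn dist (f^[n] '' U)} ∈ F)
    {A : Set X} (hA : IsCompact A) (hAn : A.Nonempty) {r : ℝ} (hr : 0 < r) :
    ∃ N ∈ F, ∀ n ∈ N, ∃ w w' : Set X, w.Finite ∧ w'.Finite ∧ w.Nonempty ∧ w'.Nonempty ∧
      (∀ x ∈ A, ∃ y ∈ w, dist x y ≤ r) ∧ (∀ y ∈ w, ∃ x ∈ A, dist y x ≤ r) ∧
      (∀ x ∈ A, ∃ y ∈ w', dist x y ≤ r) ∧ (∀ y ∈ w', ∃ x ∈ A, dist y x ≤ r) ∧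
      ε / 4 < dH (f^[n] '' w) (f^[n] '' w') := by
  obtain ⟨t, htA, htf, hcov⟩ := hA.finite_cover_balls (half_pos hr)
  obtain ⟨x₀, hx₀⟩ := hAn
  refine ⟨⋂ x ∈ t, {n : ℕ | ε < diamIn dist (f^[n] '' ball x (r / 2))},
    hF.biInter_mem hfil htf fun x _ => h _ (isOpenIn_univ_ball x _)
      ⟨x, mem_ball_self (half_pos hr)⟩, fun n hn => ?_⟩
  have key : ∀ x ∈ t, ∃ u ∈ ball x (r / 2), ε / 2 < dist (f^[n] u) (f^[n] x₀) := by
    intro x hx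
    obtain ⟨u, hu, v, hv, huv⟩ := exists_lt_of_lt_diamIn ⟨x, mem_ball_self (half_pos hr)⟩
      (mem_iInter₂.1 hn x hx)
    by_contra! H
    have h₁ := H u hu
    have h₂ := H v hv
    have h₃ := dist_triangle_right (f^[n] u) (f^[n] v) (f^[n] x₀)
    linarith
  choose! u hu hud using key
  have h₁ : ∀ x ∈ A, ∃ y ∈ u '' t, dist x y ≤ r := by
    intro x hx
    obtain ⟨z, hz, hxz⟩ := mem_iUnion₂.1 (hcov hx)
    refine ⟨u z, mem_image_of_mem u hz, ?_⟩
    have h₂ := hu z hz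
    rw [mem_ball] at hxz h₂
    have h₃ := dist_triangle_right x (u z) z
    linarith
  have h₂ : ∀ y ∈ u '' t, ∃ x ∈ A, dist y x ≤ r := by
    rintro _ ⟨z, hz, rfl⟩
    refine ⟨z, htA hz, ?_⟩
    have h₃ := hu z hz
    rw [mem_ball] at h₃
    linarith
  have hw : (u '' t).Nonempty := by
    obtain ⟨y, hy, _⟩ := h₁ x₀ hx₀
    exact ⟨y, hy⟩
  refine ⟨u '' t, insert x₀ (u '' t), htf.image u, (htf.image u).insert x₀, hw,
    insert_nonempty _ _, h₁, h₂, ?_, ?_, ?_⟩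
  · intro x hx
    obtain ⟨y, hy, hxy⟩ := h₁ x hx
    exact ⟨y, mem_insert_of_mem _ hy, hxy⟩
  · rintro y (rfl | hy)
    · exact ⟨y, hx₀, by simpa using hr.le⟩
    · exact h₂ y hy
  · by_contra! H
    obtain ⟨_, ⟨_, ⟨z, hz, rfl⟩, rfl⟩, hlt⟩ := exists_dist_lt_of_dH_lt (hw.image f^[n])
      ((insert_nonempty x₀ (u '' t)).image f^[n]) (r := ε / 2) (by linarith)
      (mem_image_of_mem _ (mem_insert x₀ _))
    exact (hud z hz).not_gt hlt

lemma isFuzzy_of_isClosed_cut {X : Type*} [TopologicalSpace X] {A : X → ℝ}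
    (hI : ∀ x, A x ∈ I01) (h : ∀ α ∈ Ioc (0 : ℝ) 1, IsClosed (cut A α)) : IsFuzzy A := by
  refine ⟨upperSemicontinuous_iff_isClosed_preimage.2 fun α => ?_, hI⟩
  change IsClosed (cut A α)
  rcases le_or_gt α 0 with h₀ | h₀
  · rw [show cut A α = univ from eq_univ_of_forall fun x => h₀.trans (hI x).1]
    exact isClosed_univ
  rcases le_or_gt α 1 with h₁ | h₁
  · exact h α ⟨h₀, h₁⟩
  · rw [show cut A α = ∅ from eq_empty_of_forall_notMem fun x hx =>
      (hx.trans (hI x).2).not_gt h₁]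
    exact isClosed_empty

lemma IsFuzzy.isClosed_cut {X : Type*} [TopologicalSpace X] {A : X → ℝ} (hA : IsFuzzy A)
    (α : ℝ) : IsClosed (cut A α) :=
  upperSemicontinuous_iff_isClosed_preimage.1 hA.1 α

lemma InF1.cut_nonempty {X : Type*} [TopologicalSpace X] {A : X → ℝ} (hA : InF1 A) {α : ℝ}
    (hα : α ≤ 1) : (cut A α).Nonempty :=
  let ⟨x, hx⟩ := hA.2
  ⟨x, hα.trans hx⟩

/-- The Galois-type property of `ξ_g`: superlevel sets of `g` are closed half-lines. -/
lemma Dm.exists_le_iff {g : ℝ → ℝ} (hg : Dm g) {α : ℝ} (hα : α ∈ Ioc (0 : ℝ) 1) :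
    ∃ β ∈ Ioc (0 : ℝ) 1, ∀ t ∈ I01, (α ≤ g t ↔ β ≤ t) := by
  obtain ⟨hmono, hcont, -, h0, h1⟩ := hg
  set S : Set ℝ := {t | t ∈ I01 ∧ α ≤ g t}
  have h1S : (1 : ℝ) ∈ S := ⟨right_mem_Icc.2 zero_le_one, hα.2.trans_eq h1.symm⟩
  have hbdd : BddBelow S := ⟨0, fun t ht => ht.1.1⟩
  have hI : sInf S ∈ I01 := ⟨le_csInf ⟨1, h1S⟩ fun t ht => ht.1.1, csInf_le hbdd h1S⟩
  have hmem : α ≤ g (sInf S) := by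
    have hSsub : S ⊆ I01 ∩ Ici (sInf S) := fun t ht => ⟨ht.1, csInf_le hbdd ht⟩
    have hcl : sInf S ∈ closure S := csInf_mem_closure ⟨1, h1S⟩ hbdd
    have := mem_closure_iff_nhdsWithin_neBot.1 hcl
    exact ge_of_tendsto ((hcont _ hI).mono hSsub)
      (Filter.eventually_of_mem self_mem_nhdsWithin fun t ht => ht.2)
  refine ⟨sInf S, ⟨hI.1.lt_of_ne fun h => ?_, hI.2⟩, fun t ht => ⟨fun h => csInf_le hbdd ⟨ht, h⟩,
    fun h => hmem.trans (hmono hI ht h)⟩⟩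
  rw [← h, h0] at hmem
  exact hα.1.not_ge hmem

section Fuzzification

variable {X : Type*} [MetricSpace X] {f : X → X} {g : ℝ → ℝ}

lemma fuzz_mem_I01 (hg : Dm g) {A : X → ℝ} (hA : IsFuzzy A) (x : X) : fuzz f g A x ∈ I01 := by
  constructor
  · refine Real.sSup_nonneg ?_
    rintro _ ⟨y, _, rfl⟩
    exact (hg.2.2.1 (hA.2 y)).1
  · refine Real.sSup_le ?_ zero_le_one
    rintro _ ⟨y, _, rfl⟩
    exact (hg.2.2.1 (hA.2 y)).2

variable [CompactSpace X]

lemma cut_fuzz (hf : Continuous f) (hg : Dm g) {A : X → ℝ} (hA : IsFuzzy A) {α β : ℝ}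
    (hα : α ∈ Ioc (0 : ℝ) 1) (hβ : ∀ t ∈ I01, (α ≤ g t ↔ β ≤ t)) :
    cut (fuzz f g A) α = f '' cut A β := by
  have hbdd : ∀ x, BddAbove ((fun y => g (A y)) '' (f ⁻¹' {x})) := by
    refine fun x => ⟨1, ?_⟩
    rintro _ ⟨y, _, rfl⟩
    exact (hg.2.2.1 (hA.2 y)).2
  ext x
  constructor
  · intro hx
    change α ≤ sSup _ at hx
    have hfib : (f ⁻¹' {x}).Nonempty := by
      by_contra hne
      rw [not_nonempty_iff_eq_empty.1 hne, image_empty, Real.sSup_empty] at hx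
      exact hα.1.not_ge hx
    have husc : UpperSemicontinuousOn (fun y => g (A y)) (f ⁻¹' {x}) := by
      have : IsFuzzy fun y => g (A y) := by
        refine isFuzzy_of_isClosed_cut (fun y => hg.2.2.1 (hA.2 y)) fun γ hγ => ?_
        obtain ⟨δ, -, hδ⟩ := hg.exists_le_iff hγ
        rw [show cut (fun y => g (A y)) γ = cut A δ from ext fun y => hδ _ (hA.2 y)]
        exact hA.isClosed_cut δ
      exact this.1.upperSemicontinuousOn _
    obtain ⟨y, hy, hmax⟩ := husc.exists_isMaxOn hfib
      (isClosed_singleton.preimage hf).isCompact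
    refine ⟨y, (hβ _ (hA.2 y)).1 (hx.trans (csSup_le (hfib.image _) ?_)), hy⟩
    rintro _ ⟨z, hz, rfl⟩
    exact hmax hz
  · rintro ⟨y, hy, rfl⟩
    exact ((hβ _ (hA.2 y)).2 hy).trans (le_csSup (hbdd _) ⟨y, rfl, rfl⟩)

lemma IsFuzzy.fuzz (hf : Continuous f) (hg : Dm g) {A : X → ℝ} (hA : IsFuzzy A) :
    IsFuzzy (fuzz f g A) := by
  refine isFuzzy_of_isClosed_cut (fuzz_mem_I01 hg hA) fun α hα => ?_
  obtain ⟨β, -, hβ⟩ := hg.exists_le_iff hα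
  rw [cut_fuzz hf hg hA hα hβ]
  exact ((hA.isClosed_cut β).isCompact.image hf).isClosed

lemma exists_cut_iterate_fuzz (hf : Continuous f) (hg : Dm g) (n : ℕ) {α : ℝ}
    (hα : α ∈ Ioc (0 : ℝ) 1) :
    ∃ β ∈ Ioc (0 : ℝ) 1, ∀ A : X → ℝ, IsFuzzy A →
      cut ((_root_.fuzz f g)^[n] A) α = f^[n] '' cut A β := by
  induction n with
  | zero => exact ⟨α, hα, by simp⟩
  | succ n ih =>
    obtain ⟨β, hβI, hβ⟩ := ih
    obtain ⟨γ, hγI, hγ⟩ := hg.exists_le_iff hβI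
    refine ⟨γ, hγI, fun A hA => ?_⟩
    rw [Function.iterate_succ_apply, hβ _ (hA.fuzz hf hg), cut_fuzz hf hg hA hβI hγ,
      ← image_comp, ← Function.iterate_succ]

lemma cut_one_iterate_fuzz (hf : Continuous f) (hg : Dm g)
    (hg1 : ∀ t ∈ I01, (g t = 1 ↔ t = 1)) (n : ℕ) {A : X → ℝ} (hA : IsFuzzy A) :
    cut ((_root_.fuzz f g)^[n] A) 1 = f^[n] '' cut A 1 := by
  induction n generalizing A with
  | zero => simp
  | succ n ih =>
    have h : ∀ t ∈ I01, (1 ≤ g t ↔ 1 ≤ t) := fun t ht => by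
      rw [(hg.2.2.1 ht).2.ge_iff_eq', ht.2.ge_iff_eq']
      rw [eq_comm, hg1 t ht, eq_comm]
    rw [Function.iterate_succ_apply, ih (hA.fuzz hf hg),
      cut_fuzz hf hg hA (right_mem_Ioc.2 one_pos) h, ← image_comp, ← Function.iterate_succ]

end Fuzzification

open Classical in
/-- The fuzzy set `A` truncated at height `s`, with the points of `w` raised to level `1`. -/
def raise {X : Type*} (A : X → ℝ) (s : ℝ) (w : Set X) : X → ℝ :=
  fun x => if x ∈ w then 1 else min (A x) s

lemma cut_raise_of_le {X : Type*} {A : X → ℝ} {s α : ℝ} (w : Set X) (hs : α ≤ s) (hα : α ≤ 1) :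
    cut (raise A s w) α = cut A α ∪ w := by
  ext x
  by_cases hx : x ∈ w <;> simp [cut, raise, hx, hs, hα]

lemma cut_raise_of_lt {X : Type*} {A : X → ℝ} {s α : ℝ} (w : Set X) (hs : s < α) (hα : α ≤ 1) :
    cut (raise A s w) α = w := by
  ext x
  by_cases hx : x ∈ w <;> simp [cut, raise, hx, hs, hα]

lemma InF1.raise {X : Type*} [TopologicalSpace X] [T1Space X] {A : X → ℝ} (hA : IsFuzzy A)
    {s : ℝ} (hs : 0 ≤ s) {w : Set X} (hw : w.Finite) (hwn : w.Nonempty) :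
    InF1 (raise A s w) := by
  refine ⟨isFuzzy_of_isClosed_cut (fun x => ?_) fun α hα => ?_, ?_⟩
  · by_cases hx : x ∈ w
    · simp [_root_.raise, hx, I01]
    · simp only [_root_.raise, hx, if_false]
      exact ⟨le_min (hA.2 x).1 hs, (min_le_left _ _).trans (hA.2 x).2⟩
  · rcases le_or_gt α s with h | h
    · rw [cut_raise_of_le w h hα.2]
      exact (hA.isClosed_cut α).union hw.isClosed
    · rw [cut_raise_of_lt w h hα.2]
      exact hw.isClosed
  · obtain ⟨x, hx⟩ := hwn
    exact ⟨x, by simp [_root_.raise, hx]⟩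

section Sensitivity

variable {X : Type*} [MetricSpace X]

lemma dInfty_raise_le {A : X → ℝ} (hA : InF1 A) {r s : ℝ} (hr : 0 ≤ r)
    (hs : ∀ x, s < A x → ∃ y ∈ cut A 1, dist x y < r) {w : Set X} (hwn : w.Nonempty)
    (h₁ : ∀ x ∈ cut A 1, ∃ y ∈ w, dist x y ≤ r) (h₂ : ∀ y ∈ w, ∃ x ∈ cut A 1, dist y x ≤ r) :
    dInfty A (raise A s w) ≤ 2 * r := by
  refine dInfty_le fun α hα => ?_
  have hsub : cut A 1 ⊆ cut A α := fun x hx => hα.2.trans hx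
  have hw : ∀ y ∈ w, ∃ x ∈ cut A α, dist y x ≤ 2 * r := fun y hy => by
    obtain ⟨x, hx, hyx⟩ := h₂ y hy
    exact ⟨x, hsub hx, by linarith⟩
  rcases le_or_gt α s with h | h
  · rw [cut_raise_of_le w h hα.2, dH_of_nonempty (hA.cut_nonempty hα.2) (hwn.inr)]
    refine hausdorffDist_le_of_mem_dist (by linarith)
      (fun x hx => ⟨x, Or.inl hx, by simpa using hr⟩) ?_
    rintro x (hx | hx)
    · exact ⟨x, hx, by simpa using hr⟩
    · exact hw x hx
  · rw [cut_raise_of_lt w h hα.2, dH_of_nonempty (hA.cut_nonempty hα.2) hwn]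
    refine hausdorffDist_le_of_mem_dist (by linarith) (fun x hx => ?_) hw
    obtain ⟨y, hy, hxy⟩ := hs x (h.trans_le hx)
    obtain ⟨z, hz, hyz⟩ := h₁ y hy
    exact ⟨z, hz, by linarith [dist_triangle x y z]⟩

lemma IsOpenIn.exists_ball_subset {U : Set X} (hU : IsOpenIn univ dist U) {x : X} (hx : x ∈ U) :
    ∃ r > 0, ball x r ⊆ U := by
  obtain ⟨r, hr, h⟩ := hU.2 x hx
  exact ⟨r, hr, fun y hy => h y (mem_univ y) (by rwa [dist_comm])⟩

variable [CompactSpace X]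

/-- High cuts of `A` are close to its `1`-cut. -/
lemma IsFuzzy.exists_cut_subset {A : X → ℝ} (hA : IsFuzzy A) {r : ℝ} (hr : 0 < r) :
    ∃ s, 0 ≤ s ∧ s < 1 ∧ ∀ x, s < A x → ∃ y ∈ cut A 1, dist x y < r := by
  rcases ((thickening r (cut A 1))ᶜ).eq_empty_or_nonempty with h | h
  · refine ⟨0, le_rfl, one_pos, fun x _ => mem_thickening_iff.1 ?_⟩
    rw [compl_empty_iff.1 h]
    trivial
  · obtain ⟨z, hz, hmax⟩ := (hA.1.upperSemicontinuousOn _).exists_isMaxOn h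
      isOpen_thickening.isClosed_compl.isCompact
    refine ⟨A z, (hA.2 z).1, lt_of_not_ge fun h1 => hz (self_subset_thickening hr _ h1),
      fun x hx => mem_thickening_iff.1 ?_⟩
    by_contra hxt
    exact hx.not_ge (hmax hxt)

variable {f : X → X} {F : Set (Set ℕ)}

lemma FSensitiveOn.hyperspace (hF : FurstenbergFamily F)
    (hfil : ∀ F1 ∈ F, ∀ F2 ∈ F, F1 ∩ F2 ∈ F) (h : FSensitiveOn (univ : Set X) dist f F) :
    FSensitiveOn (Kc X) dH (Set.image f) F := by
  obtain ⟨ε, hε, h⟩ := h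
  refine ⟨ε / 4, by positivity, fun U hU ⟨A, hAU⟩ => ?_⟩
  obtain ⟨r, hr, hball⟩ := hU.2 A hAU
  have hA := hU.1 hAU
  obtain ⟨N, hN, hNw⟩ := exists_finite_approx hF hfil hε h hA.1 hA.2 (half_pos hr)
  refine hF.1 N _ hN fun n hn => ?_
  obtain ⟨w, w', hw, hw', hwn, hwn', h₁, h₂, h₁', h₂', hlt⟩ := hNw n hn
  have mem : ∀ v : Set X, v.Finite → v.Nonempty → (∀ x ∈ A, ∃ y ∈ v, dist x y ≤ r / 2) →
      (∀ y ∈ v, ∃ x ∈ A, dist y x ≤ r / 2) → v ∈ U := fun v hv hvn h₁ h₂ => by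
    refine hball v ⟨hv.isCompact, hvn⟩ ?_
    rw [dH_of_nonempty hA.2 hvn]
    exact (hausdorffDist_le_of_mem_dist (half_pos hr).le h₁ h₂).trans_lt (half_lt_self hr)
  refine lt_diamIn dH_le_diam_univ (mem_image_of_mem _ (mem w hw hwn h₁ h₂))
    (mem_image_of_mem _ (mem w' hw' hwn' h₁' h₂')) ?_
  rwa [← image_iterate_eq]

lemma FSensitiveOn.fuzzification (hf : Continuous f) (hF : FurstenbergFamily F)
    (hfil : ∀ F1 ∈ F, ∀ F2 ∈ F, F1 ∩ F2 ∈ F) (h : FSensitiveOn (univ : Set X) dist f F)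
    {g : ℝ → ℝ} (hg : Dm g) (hg1 : ∀ t ∈ I01, (g t = 1 ↔ t = 1)) :
    FSensitiveOn {A : X → ℝ | InF1 A} dInfty (fuzz f g) F := by
  obtain ⟨ε, hε, h⟩ := h
  refine ⟨ε / 4, by positivity, fun U hU ⟨A, hAU⟩ => ?_⟩
  obtain ⟨r, hr, hball⟩ := hU.2 A hAU
  have hA : InF1 A := hU.1 hAU
  have hr4 : 0 < r / 4 := by positivity
  obtain ⟨s, hs0, hs1, hs⟩ := hA.1.exists_cut_subset hr4
  obtain ⟨N, hN, hNw⟩ := exists_finite_approx hF hfil hε h (hA.1.isClosed_cut 1).isCompact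
    (hA.cut_nonempty le_rfl) hr4
  refine hF.1 N _ hN fun n hn => ?_
  obtain ⟨w, w', hw, hw', hwn, hwn', h₁, h₂, h₁', h₂', hlt⟩ := hNw n hn
  have mem : ∀ v : Set X, v.Finite → v.Nonempty → (∀ x ∈ cut A 1, ∃ y ∈ v, dist x y ≤ r / 4) →
      (∀ y ∈ v, ∃ x ∈ cut A 1, dist y x ≤ r / 4) → raise A s v ∈ U := fun v hv hvn h₁ h₂ =>
    hball _ (InF1.raise hA.1 hs0 hv hvn)
      ((dInfty_raise_le hA hr4.le hs hvn h₁ h₂).trans_lt (by linarith))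
  refine lt_diamIn dInfty_le_diam_univ (mem_image_of_mem _ (mem w hw hwn h₁ h₂))
    (mem_image_of_mem _ (mem w' hw' hwn' h₁' h₂')) (lt_of_lt_of_le ?_
      (dH_cut_le_dInfty _ _ (right_mem_Ioc.2 one_pos)))
  rwa [cut_one_iterate_fuzz hf hg hg1 n (InF1.raise hA.1 hs0 hw hwn).1,
    cut_one_iterate_fuzz hf hg hg1 n (InF1.raise hA.1 hs0 hw' hwn').1,
    cut_raise_of_lt w hs1 le_rfl, cut_raise_of_lt w' hs1 le_rfl]

lemma subset_closedBall_of_dH_lt {A B : Set X} (hA : A.Nonempty) (hB : B.Nonempty) {x : X}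
    {r δ : ℝ} (h : dH A B < δ) (hAr : A ⊆ closedBall x r) : B ⊆ closedBall x (r + δ) := by
  intro b hb
  obtain ⟨a, ha, hab⟩ := exists_dist_lt_of_dH_lt hA hB h hb
  have h₁ := mem_closedBall.1 (hAr ha)
  rw [mem_closedBall]
  linarith [dist_triangle_left b x a]

lemma FSensitiveOn.of_hyperspace (hF : FurstenbergFamily F)
    (h : FSensitiveOn (Kc X) dH (Set.image f) F) : FSensitiveOn (univ : Set X) dist f F := by
  obtain ⟨ε, hε, h⟩ := h
  refine ⟨ε, hε, fun U hU ⟨x, hx⟩ => ?_⟩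
  obtain ⟨r, hr, hball⟩ := hU.exists_ball_subset hx
  set V : Set (Set X) := {A | A ∈ Kc X ∧ ∃ r' < r, A ⊆ closedBall x r'}
  have hVo : IsOpenIn (Kc X) dH V := by
    refine ⟨fun A hA => hA.1, fun A ⟨hA, r', hr', hAr⟩ => ⟨(r - r') / 2, by linarith,
      fun B hB hAB => ⟨hB, r' + (r - r') / 2, by linarith,
        subset_closedBall_of_dH_lt hA.2 hB.2 hAB hAr⟩⟩⟩
  have hVn : V.Nonempty := ⟨{x}, ⟨isCompact_singleton, singleton_nonempty x⟩, 0, hr, by simp⟩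
  have hVU : ∀ A ∈ V, A ⊆ U := fun A ⟨_, r', hr', hAr⟩ =>
    hAr.trans ((closedBall_subset_ball hr').trans hball)
  refine hF.1 _ _ (h V hVo hVn) fun n hn => ?_
  obtain ⟨A, hA, B, hB, hAB⟩ := exists_lt_of_lt_diamIn hVn hn
  rw [← image_iterate_eq] at hAB
  obtain ⟨_, ⟨a, ha, rfl⟩, _, ⟨b, hb, rfl⟩, hab⟩ :=
    exists_lt_dist_of_lt_dH hε.le (hA.1.2.image _) (hB.1.2.image _) hAB
  exact lt_diamIn dist_le_diam_univ (mem_image_of_mem _ (hVU A hA ha))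
    (mem_image_of_mem _ (hVU B hB hb)) hab

lemma FSensitiveOn.of_fuzzification (hf : Continuous f) (hF : FurstenbergFamily F)
    {g : ℝ → ℝ} (hg : Dm g) (h : FSensitiveOn {A : X → ℝ | InF1 A} dInfty (fuzz f g) F) :
    FSensitiveOn (univ : Set X) dist f F := by
  obtain ⟨ε, hε, h⟩ := h
  refine ⟨ε, hε, fun U hU ⟨x, hx⟩ => ?_⟩
  obtain ⟨r, hr, hball⟩ := hU.exists_ball_subset hx
  set V : Set (X → ℝ) := {A | InF1 A ∧ ∃ r' < r, ∀ α ∈ Ioc (0 : ℝ) 1,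
    cut A α ⊆ closedBall x r'}
  have hVo : IsOpenIn {A : X → ℝ | InF1 A} dInfty V := by
    refine ⟨fun A hA => hA.1, fun A ⟨hA, r', hr', hAr⟩ => ⟨(r - r') / 2, by linarith,
      fun B hB hAB => ⟨hB, r' + (r - r') / 2, by linarith, fun α hα =>
        subset_closedBall_of_dH_lt (hA.cut_nonempty hα.2) (InF1.cut_nonempty hB hα.2)
          ((dH_cut_le_dInfty A B hα).trans_lt hAB) (hAr α hα)⟩⟩⟩
  have hVn : V.Nonempty := by
    have h0 : IsFuzzy fun _ : X => (0 : ℝ) :=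
      ⟨upperSemicontinuous_const, fun _ => left_mem_Icc.2 zero_le_one⟩
    refine ⟨raise (fun _ => 0) 0 {x}, InF1.raise h0 le_rfl (finite_singleton x)
      (singleton_nonempty x), 0, hr, fun α hα => ?_⟩
    rw [cut_raise_of_lt _ hα.1 hα.2]
    simp
  have hVU : ∀ A ∈ V, ∀ α ∈ Ioc (0 : ℝ) 1, cut A α ⊆ U := fun A ⟨_, r', hr', hAr⟩ α hα =>
    (hAr α hα).trans ((closedBall_subset_ball hr').trans hball)
  refine hF.1 _ _ (h V hVo hVn) fun n hn => ?_
  obtain ⟨A, hA, B, hB, hAB⟩ := exists_lt_of_lt_diamIn hVn hn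
  obtain ⟨α, hα, hlt⟩ := exists_lt_dH_of_lt_dInfty hAB
  obtain ⟨β, hβ, hcut⟩ := exists_cut_iterate_fuzz hf hg n hα
  rw [hcut A hA.1.1, hcut B hB.1.1] at hlt
  obtain ⟨_, ⟨a, ha, rfl⟩, _, ⟨b, hb, rfl⟩, hab⟩ := exists_lt_dist_of_lt_dH hε.le
    ((hA.1.cut_nonempty hβ.2).image _) ((hB.1.cut_nonempty hβ.2).image _) hlt
  exact lt_diamIn dist_le_diam_univ (mem_image_of_mem _ (hVU A hA β hβ ha))
    (mem_image_of_mem _ (hVU B hB β hβ hb)) hab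

end Sensitivity

lemma dm_id : Dm id :=
  ⟨monotone_id.monotoneOn _, fun _ _ => continuous_id.continuousWithinAt, mapsTo_id _, rfl, rfl⟩


/-- For a Furstenberg family `𝓕` which is a filter, TFAE:
(1) `(X,f)` is `𝓕`-sensitive; (2) `(K(X), f̄)` is `𝓕`-sensitive;
(3) `(F^1(X), f̃_g)` is `𝓕`-sensitive for some `g ∈ D_m(I)` with `g⁻¹(1) = {1}`;
(4) the same for every such `g`. -/
theorem stmt12 {X : Type*} [MetricSpace X] [CompactSpace X]
    (f : X → X) (hf : Continuous f)
    (F : Set (Set ℕ)) (hF : FurstenbergFamily F)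
    (hfil : ∀ F1 ∈ F, ∀ F2 ∈ F, F1 ∩ F2 ∈ F) :
    List.TFAE
      [FSensitiveOn (Set.univ : Set X) dist f F,
       FSensitiveOn (Kc X) dH (Set.image f) F,
       ∃ g : ℝ → ℝ, Dm g ∧ (∀ t ∈ I01, (g t = 1 ↔ t = 1)) ∧
         FSensitiveOn {A : X → ℝ | InF1 A} dInfty (fuzz f g) F,
       ∀ g : ℝ → ℝ, Dm g → (∀ t ∈ I01, (g t = 1 ↔ t = 1)) →
         FSensitiveOn {A : X → ℝ | InF1 A} dInfty (fuzz f g) F] := by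
  tfae_have 1 → 2 := FSensitiveOn.hyperspace hF hfil
  tfae_have 2 → 1 := FSensitiveOn.of_hyperspace hF
  tfae_have 1 → 4 := fun h _ hg hg1 => h.fuzzification hf hF hfil hg hg1
  tfae_have 4 → 3 := fun h => ⟨id, dm_id, fun _ _ => Iff.rfl, h id dm_id fun _ _ => Iff.rfl⟩
  tfae_have 3 → 1 := fun ⟨_, hg, _, h⟩ => h.of_fuzzification hf hF hg
  tfae_finish
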